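/- arXiv:0802.2981 — 2 statements merged into one kernel-verified Lean document; each statement's English description precedes it below -/
import Mathlib

section
/- Every element of finite order in a Coxeter group W(Γ) is conjugate in W(Γ) to an element of a finite visible subgroup W(Δ), for some subsymbol Δ ⊆ Γ. -/
open Finsupp
namespace CoxeterMatrix
variable {B : Type*} (M : CoxeterMatrix B)

/-- The simple coroot `α_i^∨`, as a functional on the space with basis the simple roots:
`α_i^∨(α_j) = -2 cos (π / m_{ij})`, where `π / 0 = 0` accounts for `m_{ij} = ∞`. -/
noncomputable def coroot (i : B) : (B →₀ ℝ) →ₗ[ℝ] ℝ :=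
  Finsupp.linearCombination ℝ fun j ↦ -2 * Real.cos (Real.pi / M i j)

lemma coroot_single (i j : B) (c : ℝ) :
    M.coroot i (single j c) = c * (-2 * Real.cos (Real.pi / M i j)) := by
  simp [coroot]

lemma coroot_single_self (i : B) : M.coroot i (single i 1) = 2 := by
  simp [coroot_single]

lemma coroot_single_comm (i j : B) :
    M.coroot i (single j 1) = M.coroot j (single i 1) := by
  simp [coroot_single, M.symmetric i j]

/-- The simple reflection `v ↦ v - α_i^∨(v) α_i`. -/
noncomputable def simpleReflection (i : B) : (B →₀ ℝ) ≃ₗ[ℝ] (B →₀ ℝ) :=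
  Module.reflection (M.coroot_single_self i)

lemma simpleReflection_apply (i : B) (v : B →₀ ℝ) :
    M.simpleReflection i v = v - M.coroot i v • single i 1 :=
  Module.reflection_apply _ _

open Polynomial.Chebyshev in
lemma S_eval_mul_sin (φ : ℝ) (n : ℤ) :
    (S ℝ n).eval (2 * Real.cos φ) * Real.sin φ = Real.sin ((n + 1) * φ) := by
  rw [← U_real_cos φ n]
  congr 1
  simpa using congrArg (Polynomial.eval (Real.cos φ)) (S_comp_two_mul_X ℝ n)

lemma isLiftable_simpleReflection : M.IsLiftable M.simpleReflection := by
  intro i j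
  rcases Nat.eq_zero_or_pos (M i j) with h0 | h0
  · simp [h0]
  rcases eq_or_ne i j with rfl | hij
  · have := Module.involutive_reflection (M.coroot_single_self i)
    ext1 v
    simp only [M.diagonal, pow_one]
    exact this v
  have h1 : M i j ≠ 1 := fun h ↦ M.off_diagonal i j hij h
  have hcos : M.coroot i (single j 1) * M.coroot j (single i 1) - 2
      = 2 * Real.cos (2 * (Real.pi / M i j)) := by
    rw [coroot_single_comm, coroot_single, M.symmetric j i, Real.cos_two_mul]; ring
  ext1 v
  unfold simpleReflection
  rw [Module.reflection_mul_reflection_pow_apply _ _ _ _ _ hcos.symm]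
  obtain h2 | h3 : M i j = 2 ∨ 3 ≤ M i j := by omega
  · have e1 : M.coroot i (single j 1) = 0 := by simp [coroot_single, h2]
    have e2 : M.coroot j (single i 1) = 0 := by rw [coroot_single_comm, e1]
    have e3 : 2 * Real.cos (2 * (Real.pi / M i j)) = -2 := by rw [← hcos, e1]; ring
    rw [e3, h2]
    norm_num [e1, e2]
    module
  set θ := Real.pi / M i j with hθ
  have hM : (M i j : ℝ) * θ = Real.pi := by rw [hθ]; field_simp
  have hM3 : (3 : ℝ) ≤ M i j := by exact_mod_cast h3
  have hsin : Real.sin (2 * θ) ≠ 0 := by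
    apply ne_of_gt
    have hp := Real.pi_pos
    have : 0 < θ := by positivity
    apply Real.sin_pos_of_pos_of_lt_pi
    · positivity
    · nlinarith
  generalize M i j = m at *
  rcases Nat.even_or_odd' m with ⟨n, rfl | rfl⟩
  · have : (Polynomial.Chebyshev.S ℝ (n - 1)).eval (2 * Real.cos (2 * θ)) = 0 := by
      refine (mul_eq_zero.1 ((S_eval_mul_sin _ _).trans ?_)).resolve_right hsin
      push_cast at hM ⊢
      rw [← Real.sin_pi, ← hM]; ring_nf
    rw [show (((2 * n : ℕ) : ℤ) - 2) / 2 = n - 1 by omega,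
      show (((2 * n : ℕ) : ℤ) - 1) / 2 = n - 1 by omega, this]
    simp
  · have : (Polynomial.Chebyshev.S ℝ n).eval (2 * Real.cos (2 * θ)) +
        (Polynomial.Chebyshev.S ℝ (n - 1)).eval (2 * Real.cos (2 * θ)) = 0 := by
      refine (mul_eq_zero.1 ((add_mul _ _ _).trans ?_)).resolve_right hsin
      rw [S_eval_mul_sin, S_eval_mul_sin]
      push_cast at hM ⊢
      rw [show ((n : ℝ) + 1) * (2 * θ) = θ + Real.pi by rw [← hM]; ring,
        show ((n : ℝ) - 1 + 1) * (2 * θ) = Real.pi - θ by rw [← hM]; ring,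
        Real.sin_add_pi, Real.sin_pi_sub]
      ring
    rw [show (((2 * n + 1 : ℕ) : ℤ) - 2) / 2 = n - 1 by omega,
      show (((2 * n + 1 : ℕ) : ℤ) - 1) / 2 = n by omega,
      show (((2 * n + 1 : ℕ) : ℤ) - 3) / 2 = n - 1 by omega,
      show (((2 * n + 1 : ℕ) : ℤ)) / 2 = n by omega, this]
    simp

/-- The coefficients `p k` of the roots of a dihedral group are nonnegative up to `k = m`
(for all `k` when `m = 0` stands for `∞`). -/
lemma exists_dihedral_coeff (m : ℕ) (hm : m ≠ 1) :
    ∃ p : ℕ → ℝ, p 0 = 0 ∧ p 1 = 1 ∧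
      (∀ k, p (k + 2) = 2 * Real.cos (Real.pi / m) * p (k + 1) - p k) ∧
      ∀ k, (m ≠ 0 → k ≤ m) → 0 ≤ p k := by
  rcases eq_or_ne m 0 with rfl | h0
  · refine ⟨fun k ↦ k, by simp, by simp, fun k ↦ ?_, fun k _ ↦ k.cast_nonneg⟩
    push_cast; simp; ring
  have h2 : (2 : ℝ) ≤ m := by exact_mod_cast (by omega : 2 ≤ m)
  have hp := Real.pi_pos
  set θ := Real.pi / m with hθ
  have hM : (m : ℝ) * θ = Real.pi := by rw [hθ]; field_simp
  have hθ0 : 0 < θ := by positivity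
  have hsin : 0 < Real.sin θ := Real.sin_pos_of_pos_of_lt_pi hθ0 (by nlinarith)
  refine ⟨fun k ↦ Real.sin (k * θ) / Real.sin θ, by simp, by simp [hsin.ne'], fun k ↦ ?_,
    fun k hk ↦ div_nonneg (Real.sin_nonneg_of_nonneg_of_le_pi (by positivity) ?_) hsin.le⟩
  · have := Real.sin_add_sin ((k + 2 : ℕ) * θ) (k * θ)
    push_cast at this ⊢
    rw [show ((k + 2) * θ + k * θ) / 2 = (k + 1) * θ by ring,
      show ((k + 2) * θ - k * θ) / 2 = θ by ring] at this
    rw [eq_sub_of_add_eq this]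
    field_simp
  · rw [← hM]
    have : (k : ℝ) ≤ m := by exact_mod_cast hk h0
    gcongr

/-- The invariant bilinear form, normalised so that simple roots have square length `2`. -/
noncomputable def rootForm : (B →₀ ℝ) →ₗ[ℝ] (B →₀ ℝ) →ₗ[ℝ] ℝ :=
  Finsupp.linearCombination ℝ M.coroot

lemma rootForm_single_left (i : B) (v : B →₀ ℝ) : M.rootForm (single i 1) v = M.coroot i v := by
  simp [rootForm]

lemma rootForm_single_right (i : B) (v : B →₀ ℝ) : M.rootForm v (single i 1) = M.coroot i v := by
  have : M.rootForm.flip (single i 1) = M.coroot i := by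
    ext j
    simp [rootForm, coroot_single_comm M i j]
  exact congrArg (· v) this

lemma rootForm_simpleReflection (i : B) (v w : B →₀ ℝ) :
    M.rootForm (M.simpleReflection i v) (M.simpleReflection i w) = M.rootForm v w := by
  simp only [simpleReflection_apply, map_sub, map_smul, LinearMap.sub_apply, LinearMap.smul_apply,
    rootForm_single_left, rootForm_single_right, coroot_single_self, smul_eq_mul]
  ring

end CoxeterMatrix

namespace CoxeterSystem
variable {B : Type*} {W : Type*} [Group W] {M : CoxeterMatrix B} (cs : CoxeterSystem M W)

/-- The geometric representation of a Coxeter group. -/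
noncomputable def geomRep : W →* (B →₀ ℝ) ≃ₗ[ℝ] (B →₀ ℝ) :=
  cs.lift ⟨M.simpleReflection, M.isLiftable_simpleReflection⟩

lemma geomRep_simple (i : B) (v : B →₀ ℝ) :
    cs.geomRep (cs.simple i) v = v - M.coroot i v • single i 1 := by
  rw [geomRep, lift_apply_simple, CoxeterMatrix.simpleReflection_apply]

lemma geomRep_simple_self (i : B) :
    cs.geomRep (cs.simple i) (single i 1) = -single i 1 := by
  rw [geomRep_simple, M.coroot_single_self]; module

lemma geomRep_mul_apply (u w : W) (v : B →₀ ℝ) :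
    cs.geomRep (u * w) v = cs.geomRep u (cs.geomRep w v) := by
  rw [map_mul]; rfl

lemma geomRep_one_apply (v : B →₀ ℝ) : cs.geomRep 1 v = v := by
  rw [map_one]; rfl

lemma rootForm_geomRep (w : W) (u v : B →₀ ℝ) :
    M.rootForm (cs.geomRep w u) (cs.geomRep w v) = M.rootForm u v := by
  induction w using cs.simple_induction_left with
  | one => simp
  | mul_simple_left w i ih =>
    rw [geomRep_mul_apply, geomRep_mul_apply, ← ih]
    simpa only [geomRep, lift_apply_simple] using M.rootForm_simpleReflection i _ _

lemma exists_geomRep_alternatingWord {i j : B} (hij : i ≠ j) (k : ℕ) (hk : M i j ≠ 0 → k < M i j) :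
    ∃ a b : ℝ, 0 ≤ a ∧ 0 ≤ b ∧
      cs.geomRep (cs.wordProd (alternatingWord i j k)) (single i 1) =
        a • single i 1 + b • single j 1 := by
  obtain ⟨p, p0, p1, prec, hp⟩ :=
    CoxeterMatrix.exists_dihedral_coeff (M i j) (M.off_diagonal i j hij)
  have key : ∀ k, cs.geomRep (cs.wordProd (alternatingWord i j k)) (single i 1) =
      if Even k then p (k + 1) • single i 1 + p k • single j 1
      else p k • single i 1 + p (k + 1) • single j 1 := by
    intro k
    induction k with
    | zero => simp [alternatingWord, p0, p1]
    | succ k ih =>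
      have e1 : M.coroot i (single j 1) = -2 * Real.cos (Real.pi / M i j) := by
        simp [M.coroot_single]
      have e2 := (M.coroot_single_comm i j).symm.trans e1
      rw [alternatingWord_succ', wordProd_cons, geomRep_mul_apply, ih]
      by_cases h : Even k
      · simp only [h, if_true, Nat.even_add_one, not_true, if_false, geomRep_simple, map_add,
          map_smul, M.coroot_single_self, e2, prec]
        module
      · simp only [h, if_false, Nat.even_add_one, not_false_iff, if_true, geomRep_simple, map_add,
          map_smul, M.coroot_single_self, e1, prec]
        module
  have h1 := hp k fun h ↦ (hk h).le
  have h2 := hp (k + 1) hk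
  rw [key]
  split_ifs
  · exact ⟨_, _, h2, h1, rfl⟩
  · exact ⟨_, _, h1, h2, rfl⟩

lemma length_mul_alternatingWord_le (v : W) (i j : B) (k : ℕ) :
    cs.length (v * cs.wordProd (alternatingWord i j k)) ≤ cs.length v + k := by
  refine (cs.length_mul_le _ _).trans ?_
  simpa using cs.length_wordProd_le (alternatingWord i j k)

lemma isRightDescent_of_braidWord {v w : W} {i j : B} (h0 : M i j ≠ 0)
    (hw : w = v * cs.wordProd (alternatingWord i j (M i j)))
    (hl : cs.length w = cs.length v + M i j) : cs.IsRightDescent w i := by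
  obtain ⟨m, hm⟩ := Nat.exists_eq_succ_of_ne_zero h0
  have e : w * cs.simple i = v * cs.wordProd (alternatingWord i j m) := by
    rw [hw, cs.wordProd_braidWord_eq i j, braidWord, M.symmetric j i, hm,
      alternatingWord_succ, wordProd_concat]
    simp [mul_assoc]
  have := cs.length_mul_alternatingWord_le v i j m
  rw [IsRightDescent, e]
  omega

/-- Splitting off a maximal alternating suffix. -/
lemma exists_eq_mul_alternatingWord {w : W} {i j : B} (hi : ¬cs.IsRightDescent w i)
    (hj : cs.IsRightDescent w j) :
    ∃ (v : W) (k : ℕ), w = v * cs.wordProd (alternatingWord i j k) ∧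
      cs.length v < cs.length w ∧ (M i j ≠ 0 → k < M i j) ∧
      ¬cs.IsRightDescent v i ∧ ¬cs.IsRightDescent v j := by
  classical
  let P : ℕ → Prop := fun k ↦ ∃ v, w = v * cs.wordProd (alternatingWord i j k) ∧
    cs.length w = cs.length v + k
  have hex : ∃ k, ¬P k := ⟨cs.length w + 1, fun ⟨v, _, h⟩ ↦ by omega⟩
  have hP0 : P 0 := ⟨w, by simp [alternatingWord], by simp⟩
  have hP1 : P 1 := by
    refine ⟨w * cs.simple j, by simp [alternatingWord], ?_⟩
    exact (cs.isRightDescent_iff.1 hj).symm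
  have hmin : ∀ k < Nat.find hex, P k := fun k hk ↦ not_not.1 (Nat.find_min hex hk)
  have hspec := Nat.find_spec hex
  have hle : M i j ≠ 0 → Nat.find hex ≤ M i j := fun h0 ↦ Nat.find_min' hex
    fun ⟨v, hv, hl⟩ ↦ hi (cs.isRightDescent_of_braidWord h0 hv hl)
  generalize Nat.find hex = n at *
  obtain _ | _ | k := n
  · exact absurd hP0 hspec
  · exact absurd hP1 hspec
  obtain ⟨v, hv, hl⟩ := hmin (k + 1) (by omega)
  have hnext : ¬cs.IsRightDescent v (if Even (k + 1) then j else i) := by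
    intro h
    refine hspec ⟨v * cs.simple (if Even (k + 1) then j else i), ?_, ?_⟩
    · rw [alternatingWord_succ', wordProd_cons, hv]
      simp [mul_assoc]
    · have := cs.isRightDescent_iff.1 h
      omega
  have hprev : ¬cs.IsRightDescent v (if Even k then j else i) := by
    intro h
    have e : w = v * cs.simple (if Even k then j else i) *
        cs.wordProd (alternatingWord i j k) := by
      rw [hv, alternatingWord_succ', wordProd_cons, mul_assoc]
    have h1 := cs.length_mul_alternatingWord_le (v * cs.simple (if Even k then j else i)) i j k
    rw [← e] at h1
    unfold IsRightDescent at h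
    omega
  refine ⟨v, k + 1, hv, by omega, fun h0 ↦ hle h0, ?_⟩
  by_cases h : Even k
  · simp only [Nat.even_add_one, h, not_true, if_true, if_false] at hnext hprev
    exact ⟨hnext, hprev⟩
  · simp only [Nat.even_add_one, h, not_false_iff, if_true, if_false] at hnext hprev
    exact ⟨hprev, hnext⟩

lemma geomRep_single_nonneg {w : W} {i : B} (hi : ¬cs.IsRightDescent w i) :
    0 ≤ cs.geomRep w (single i 1) := by
  induction hn : cs.length w using Nat.strong_induction_on generalizing w i with
  | _ n ih =>
    subst hn
    rcases eq_or_ne w 1 with rfl | hw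
    · rw [geomRep_one_apply]
      exact single_nonneg.2 zero_le_one
    obtain ⟨j, hj⟩ := cs.exists_rightDescent_of_ne_one hw
    have hij : i ≠ j := by rintro rfl; exact hi hj
    obtain ⟨v, k, rfl, hlt, hk, hvi, hvj⟩ := cs.exists_eq_mul_alternatingWord hi hj
    obtain ⟨a, b, ha, hb, hab⟩ := cs.exists_geomRep_alternatingWord hij k hk
    rw [geomRep_mul_apply, hab, map_add, map_smul, map_smul]
    exact add_nonneg (smul_nonneg ha (ih _ hlt hvi rfl)) (smul_nonneg hb (ih _ hlt hvj rfl))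

lemma geomRep_single_nonpos {w : W} {i : B} (hi : cs.IsRightDescent w i) :
    cs.geomRep w (single i 1) ≤ 0 := by
  have h := cs.geomRep_single_nonneg (cs.isRightDescent_iff_not_isRightDescent_mul.1 hi)
  rw [geomRep_mul_apply, geomRep_simple_self, map_neg] at h
  exact neg_nonneg.1 h

/-- The roots of a Coxeter system. -/
def geomRoots : Set (B →₀ ℝ) := {v | ∃ w i, v = cs.geomRep w (single i 1)}

lemma single_mem_geomRoots (i : B) : single i 1 ∈ cs.geomRoots :=
  ⟨1, i, (cs.geomRep_one_apply _).symm⟩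

variable {cs} in
lemma geomRep_mem_geomRoots {β : B →₀ ℝ} (hβ : β ∈ cs.geomRoots) (w : W) :
    cs.geomRep w β ∈ cs.geomRoots := by
  obtain ⟨u, i, rfl⟩ := hβ
  exact ⟨w * u, i, (cs.geomRep_mul_apply _ _ _).symm⟩

variable {cs} in
lemma ne_zero_of_mem_geomRoots {β : B →₀ ℝ} (hβ : β ∈ cs.geomRoots) : β ≠ 0 := by
  obtain ⟨w, i, rfl⟩ := hβ
  simp

variable {cs} in
lemma nonneg_or_nonpos_of_mem_geomRoots {β : B →₀ ℝ} (hβ : β ∈ cs.geomRoots) : 0 ≤ β ∨ β ≤ 0 := by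
  obtain ⟨w, i, rfl⟩ := hβ
  by_cases h : cs.IsRightDescent w i
  · exact .inr (cs.geomRep_single_nonpos h)
  · exact .inl (cs.geomRep_single_nonneg h)

variable {cs} in
lemma rootForm_self_of_mem_geomRoots {β : B →₀ ℝ} (hβ : β ∈ cs.geomRoots) : M.rootForm β β = 2 := by
  obtain ⟨w, i, rfl⟩ := hβ
  rw [rootForm_geomRep, M.rootForm_single_left, M.coroot_single_self]

lemma isRightDescent_iff_geomRep_nonpos {w : W} {i : B} :
    cs.IsRightDescent w i ↔ cs.geomRep w (single i 1) ≤ 0 := by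
  refine ⟨cs.geomRep_single_nonpos, fun h ↦ by_contra fun hi ↦ ?_⟩
  exact ne_zero_of_mem_geomRoots (geomRep_mem_geomRoots (cs.single_mem_geomRoots i) w)
    (h.antisymm (cs.geomRep_single_nonneg hi))

variable {cs} in
/-- A simple reflection makes only one positive root negative. -/
lemma eq_single_of_geomRep_simple_nonpos {β : B →₀ ℝ} (hβ : β ∈ cs.geomRoots) (h0 : 0 ≤ β) {i : B}
    (hi : cs.geomRep (cs.simple i) β ≤ 0) : β = single i 1 := by
  have hc : β = β i • single i 1 := by
    ext j
    rcases eq_or_ne j i with rfl | hij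
    · simp
    · have h1 := h0 j
      have h2 := hi j
      rw [geomRep_simple] at h2
      simp [hij] at h1 h2 ⊢
      exact le_antisymm h2 h1
  have h2 := rootForm_self_of_mem_geomRoots hβ
  have h3 : 0 ≤ β i := h0 i
  generalize β i = c at hc h3
  subst hc
  simp only [map_smul, LinearMap.smul_apply, M.rootForm_single_left, M.coroot_single_self,
    smul_eq_mul] at h2
  have : c = 1 := by nlinarith
  rw [this, one_smul]

/-- The positive roots made negative by `w`. -/
def inversionRoots (w : W) : Set (B →₀ ℝ) := {β | β ∈ cs.geomRoots ∧ 0 ≤ β ∧ cs.geomRep w β ≤ 0}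

lemma finite_inversionRoots (w : W) : (cs.inversionRoots w).Finite := by
  induction w using cs.simple_induction_left with
  | one =>
    refine Set.finite_empty.subset fun β ⟨hβ, h0, h1⟩ ↦ ne_zero_of_mem_geomRoots hβ ?_
    rw [geomRep_one_apply] at h1
    exact h1.antisymm h0
  | mul_simple_left w i ih =>
    refine (ih.union (Set.finite_singleton (cs.geomRep w⁻¹ (single i 1)))).subset ?_
    rintro β ⟨hβ, h0, h1⟩
    rw [geomRep_mul_apply] at h1
    rcases nonneg_or_nonpos_of_mem_geomRoots (geomRep_mem_geomRoots hβ w) with h | h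
    · right
      rw [Set.mem_singleton_iff,
        ← eq_single_of_geomRep_simple_nonpos (geomRep_mem_geomRoots hβ w) h h1,
        ← geomRep_mul_apply, inv_mul_cancel, geomRep_one_apply]
    · exact .inl ⟨hβ, h0, h⟩

lemma inversionRoots_injective : Function.Injective cs.inversionRoots := by
  intro u v huv
  rw [← mul_inv_eq_one]
  by_contra hne
  obtain ⟨i, hi⟩ := cs.exists_rightDescent_of_ne_one hne
  rw [isRightDescent_iff_geomRep_nonpos, geomRep_mul_apply] at hi
  have hr := geomRep_mem_geomRoots (cs.single_mem_geomRoots i) v⁻¹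
  have hv : cs.geomRep v (cs.geomRep v⁻¹ (single i 1)) = single i 1 := by
    rw [← geomRep_mul_apply, mul_inv_cancel, geomRep_one_apply]
  have hpos : (0 : B →₀ ℝ) ≤ single i 1 := single_nonneg.2 zero_le_one
  have hne0 := ne_zero_of_mem_geomRoots (cs.single_mem_geomRoots i)
  rcases nonneg_or_nonpos_of_mem_geomRoots hr with h | h
  · have : cs.geomRep v⁻¹ (single i 1) ∈ cs.inversionRoots v := huv ▸ ⟨hr, h, hi⟩
    exact hne0 ((hv ▸ this.2.2).antisymm hpos)
  · have hs : -cs.geomRep v⁻¹ (single i 1) = cs.geomRep (v⁻¹ * cs.simple i) (single i 1) := by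
      rw [geomRep_mul_apply, geomRep_simple_self, map_neg]
    have hm : -cs.geomRep v⁻¹ (single i 1) ∈ cs.inversionRoots v := by
      refine ⟨hs ▸ geomRep_mem_geomRoots (cs.single_mem_geomRoots i) _, neg_nonneg.2 h, ?_⟩
      rw [map_neg, hv]
      exact neg_nonpos.2 hpos
    rw [← huv] at hm
    have h2 := hm.2.2
    rw [map_neg, neg_nonpos] at h2
    exact ne_zero_of_mem_geomRoots (geomRep_mem_geomRoots hr u) (hi.antisymm h2)

/-- A functional that is negative on only finitely many positive roots has a dominant translate. -/
lemma exists_geomRep_dominant (φ : (B →₀ ℝ) →ₗ[ℝ] ℝ)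
    (hφ : {β | β ∈ cs.geomRoots ∧ 0 ≤ β ∧ φ β < 0}.Finite) :
    ∃ w, ∀ i, 0 ≤ φ (cs.geomRep w (single i 1)) := by
  induction hn : {β | β ∈ cs.geomRoots ∧ 0 ≤ β ∧ φ β < 0}.ncard using Nat.strong_induction_on
    generalizing φ with
  | _ n ih =>
    subst hn
    by_cases hdom : ∀ i, 0 ≤ φ (single i 1)
    · exact ⟨1, by simpa only [geomRep_one_apply] using hdom⟩
    push Not at hdom
    obtain ⟨i, hi⟩ := hdom
    set N := {β | β ∈ cs.geomRoots ∧ 0 ≤ β ∧ φ β < 0}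
    let ψ : (B →₀ ℝ) →ₗ[ℝ] ℝ := φ ∘ₗ (cs.geomRep (cs.simple i)).toLinearMap
    have hψ : ∀ v, ψ v = φ (cs.geomRep (cs.simple i) v) := fun _ ↦ rfl
    have hss : ∀ v, cs.geomRep (cs.simple i) (cs.geomRep (cs.simple i) v) = v := fun v ↦ by
      rw [← geomRep_mul_apply, simple_mul_simple_self, geomRep_one_apply]
    have hinj := (cs.geomRep (cs.simple i)).injective
    have hsub : cs.geomRep (cs.simple i) '' {β | β ∈ cs.geomRoots ∧ 0 ≤ β ∧ ψ β < 0} ⊆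
        N \ {single i 1} := by
      rintro _ ⟨β, ⟨hβ, h0, h1⟩, rfl⟩
      refine ⟨⟨geomRep_mem_geomRoots hβ _, ?_, h1⟩, fun he ↦ ?_⟩
      · refine (nonneg_or_nonpos_of_mem_geomRoots (geomRep_mem_geomRoots hβ _)).resolve_right
          fun h ↦ ?_
        rw [eq_single_of_geomRep_simple_nonpos hβ h0 h, hψ, geomRep_simple_self, map_neg] at h1
        linarith
      · have he' : β = -single i 1 := by
          rw [← hss β, Set.mem_singleton_iff.1 he, geomRep_simple_self]
        have := h0 i
        simp [he'] at this
        linarith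
    have hfin := (hφ.sdiff (t := {single i 1})).subset hsub
    have hlt : {β | β ∈ cs.geomRoots ∧ 0 ≤ β ∧ ψ β < 0}.ncard < N.ncard := by
      rw [← Set.ncard_image_of_injective _ hinj]
      refine (Set.ncard_le_ncard hsub hφ.sdiff).trans_lt ?_
      exact Set.ncard_sdiff_singleton_lt_of_mem
        ⟨cs.single_mem_geomRoots i, single_nonneg.2 zero_le_one, hi⟩ hφ
    obtain ⟨w, hw⟩ := ih _ hlt ψ (hfin.of_finite_image hinj.injOn) rfl
    exact ⟨cs.simple i * w, fun j ↦ by rw [geomRep_mul_apply]; exact hw j⟩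

section Dominant
variable {φ : (B →₀ ℝ) →ₗ[ℝ] ℝ}

lemma dominant_nonneg (hφ : ∀ i, 0 ≤ φ (single i 1)) {v : B →₀ ℝ} (hv : 0 ≤ v) : 0 ≤ φ v := by
  rw [← Finsupp.sum_single v, Finsupp.sum, map_sum]
  refine Finset.sum_nonneg fun i _ ↦ ?_
  rw [← Finsupp.smul_single_one, map_smul]
  exact mul_nonneg (hv i) (hφ i)

/-- The stabilizer of a dominant functional is a standard parabolic subgroup. -/
lemma mem_closure_of_dominant (hφ : ∀ i, 0 ≤ φ (single i 1)) {w : W}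
    (hw : ∀ v, φ (cs.geomRep w v) = φ v) :
    w ∈ Subgroup.closure (cs.simple '' {i | φ (single i 1) = 0}) := by
  induction hn : cs.length w using Nat.strong_induction_on generalizing w with
  | _ n ih =>
    subst hn
    rcases eq_or_ne w 1 with rfl | hne
    · exact one_mem _
    obtain ⟨i, hi⟩ := cs.exists_rightDescent_of_ne_one hne
    have h1 := dominant_nonneg hφ (neg_nonneg.2 (cs.geomRep_single_nonpos hi))
    rw [map_neg, hw] at h1
    have h0 : φ (single i 1) = 0 := by linarith [hφ i]
    have := ih _ hi (w := w * cs.simple i) (fun v ↦ by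
      rw [geomRep_mul_apply, hw, geomRep_simple, map_sub, map_smul, h0, smul_zero, sub_zero]) rfl
    rw [← cs.simple_mul_simple_cancel_right (w := w) i]
    exact mul_mem this (Subgroup.subset_closure ⟨i, h0, rfl⟩)

lemma apply_geomRep_of_mem_closure {w : W}
    (hw : w ∈ Subgroup.closure (cs.simple '' {i | φ (single i 1) = 0})) (v : B →₀ ℝ) :
    φ (cs.geomRep w v) = φ v := by
  induction hw using Subgroup.closure_induction generalizing v with
  | mem _ h =>
    obtain ⟨i, h0, rfl⟩ := h
    rw [geomRep_simple, map_sub, map_smul, show φ (single i 1) = 0 from h0, smul_zero, sub_zero]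
  | one => rw [geomRep_one_apply]
  | mul x y _ _ hx hy => rw [geomRep_mul_apply, hx, hy]
  | inv x _ hx => rw [← hx, ← geomRep_mul_apply, mul_inv_cancel, geomRep_one_apply]

lemma finite_closure_of_dominant (hφ : ∀ i, 0 ≤ φ (single i 1))
    (hfin : {β | β ∈ cs.geomRoots ∧ 0 ≤ β ∧ φ β = 0}.Finite) :
    Finite (Subgroup.closure (cs.simple '' {i | φ (single i 1) = 0})) := by
  refine Set.finite_coe_iff.2 ((hfin.finite_subsets.subset ?_).of_finite_image
    cs.inversionRoots_injective.injOn)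
  rintro _ ⟨w, hw, rfl⟩ β ⟨hβ, h0, h1⟩
  refine ⟨hβ, h0, le_antisymm ?_ (dominant_nonneg hφ h0)⟩
  have := dominant_nonneg hφ (neg_nonneg.2 h1)
  rw [map_neg, cs.apply_geomRep_of_mem_closure hw] at this
  linarith

end Dominant

/-- A finite subgroup of a Coxeter group is conjugate into a finite standard parabolic subgroup. -/
theorem exists_conj_mem_finite_closure (H : Subgroup W) [Finite H] :
    ∃ (T : Set B) (x : W), Finite (Subgroup.closure (cs.simple '' T)) ∧
      ∀ h ∈ H, x * h * x⁻¹ ∈ Subgroup.closure (cs.simple '' T) := by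
  classical
  have := Fintype.ofFinite H
  let ht : (B →₀ ℝ) →ₗ[ℝ] ℝ := Finsupp.linearCombination ℝ fun _ ↦ 1
  have ht_single : ∀ i, ht (single i 1) = 1 := fun i ↦ by simp [ht]
  have ht_nonneg {v : B →₀ ℝ} (hv : 0 ≤ v) : 0 ≤ ht v :=
    dominant_nonneg (fun i ↦ (ht_single i).symm ▸ zero_le_one) hv
  have ht_ne {β : B →₀ ℝ} (hβ : β ∈ cs.geomRoots) : ht β ≠ 0 := by
    intro h
    have aux {v : B →₀ ℝ} (hv : 0 ≤ v) (h0 : ht v = 0) : v = 0 := by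
      rw [show ht v = ∑ i ∈ v.support, v i by simp [ht, linearCombination_apply, Finsupp.sum],
        Finset.sum_eq_zero_iff_of_nonneg fun i _ ↦ hv i] at h0
      ext i
      by_contra hi
      exact hi (h0 i (mem_support_iff.2 hi))
    rcases nonneg_or_nonpos_of_mem_geomRoots hβ with h0 | h0
    · exact ne_zero_of_mem_geomRoots hβ (aux h0 h)
    · exact ne_zero_of_mem_geomRoots hβ
        (neg_eq_zero.1 (aux (neg_nonneg.2 h0) (by rw [map_neg, h, neg_zero])))
  let φ : (B →₀ ℝ) →ₗ[ℝ] ℝ := ∑ h : H, ht ∘ₗ (cs.geomRep h).toLinearMap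
  have hφ : ∀ v, φ v = ∑ h : H, ht (cs.geomRep h v) := fun v ↦ by simp [φ]
  have hφ_inv : ∀ h ∈ H, ∀ v, φ (cs.geomRep h v) = φ v := by
    intro h hh v
    rw [hφ, hφ]
    refine Fintype.sum_equiv (Equiv.mulRight ⟨h, hh⟩) _ _ fun k ↦ ?_
    simp
  have hfin : {β | β ∈ cs.geomRoots ∧ 0 ≤ β ∧ φ β ≤ 0}.Finite := by
    refine (Set.finite_iUnion fun h : H ↦ cs.finite_inversionRoots h).subset ?_
    rintro β ⟨hβ, h0, h1⟩
    rw [Set.mem_iUnion]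
    by_contra! hall
    rw [hφ] at h1
    refine h1.not_gt (Finset.sum_pos (fun h _ ↦ ?_) ⟨1, Finset.mem_univ _⟩)
    have hr := geomRep_mem_geomRoots hβ (h : W)
    exact (ht_nonneg ((nonneg_or_nonpos_of_mem_geomRoots hr).resolve_right
      fun h' ↦ hall h ⟨hβ, h0, h'⟩)).lt_of_ne' (ht_ne hr)
  obtain ⟨w, hw⟩ := cs.exists_geomRep_dominant φ (hfin.subset fun β h ↦ ⟨h.1, h.2.1, h.2.2.le⟩)
  let ψ : (B →₀ ℝ) →ₗ[ℝ] ℝ := φ ∘ₗ (cs.geomRep w).toLinearMap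
  have hψ : ∀ v, ψ v = φ (cs.geomRep w v) := fun _ ↦ rfl
  refine ⟨{i | ψ (single i 1) = 0}, w⁻¹, cs.finite_closure_of_dominant hw ?_, fun h hh ↦
    cs.mem_closure_of_dominant hw fun v ↦ ?_⟩
  · have := (hfin.preimage (cs.geomRep w).injective.injOn).union (cs.finite_inversionRoots w)
    refine this.subset ?_
    rintro β ⟨hβ, h0, h1⟩
    rcases nonneg_or_nonpos_of_mem_geomRoots (geomRep_mem_geomRoots hβ w) with h | h
    · exact .inl ⟨geomRep_mem_geomRoots hβ w, h, h1.le⟩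
    · exact .inr ⟨hβ, h0, h⟩
  · rw [hψ, hψ, ← hφ_inv h hh (cs.geomRep w v), ← geomRep_mul_apply, ← geomRep_mul_apply]
    congr 3
    group

end CoxeterSystem

namespace RootPaper

/-- Every element of finite order in a Coxeter group `W(Γ)` is conjugate
in `W(Γ)` to an element of a finite visible subgroup `W(Δ)`, `Δ ⊆ Γ`. -/
theorem statement0 {B : Type*} [Finite B] {W : Type*} [Group W]
    {M : CoxeterMatrix B} (cs : CoxeterSystem M W) (g : W) (hg : IsOfFinOrder g) :
    ∃ (T : Set B) (x : W),
      Finite ↥(Subgroup.closure (cs.simple '' T)) ∧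
        x * g * x⁻¹ ∈ Subgroup.closure (cs.simple '' T) := by
  have : Finite (Subgroup.zpowers g) := finite_zpowers.2 hg
  obtain ⟨T, x, hT, hx⟩ := cs.exists_conj_mem_finite_closure (Subgroup.zpowers g)
  exact ⟨T, x, hT, hx g (Subgroup.mem_zpowers g)⟩

end RootPaper
end

section
/- Let W(Ψ) be an irreducible Weyl group of rank n and (Ψ, s) an admissible pair. Then the F_2-subspace Λ_s/2 ⊆ L/2 is n-dimensional; equivalently, the W(Ψ)-orbit of ū_s spans all of L/2L over F_2. -/
namespace RootPaper

/-- The type of an irreducible Weyl symbol (Killing-Cartan type). -/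
inductive WeylType : Type
  | A : ℕ → WeylType
  | B : ℕ → WeylType
  | D : ℕ → WeylType
  | G2 : WeylType
  | F4 : WeylType
  | E6 : WeylType
  | E7 : WeylType
  | E8 : WeylType

namespace WeylType

/-- The rank (number of nodes of the symbol). -/
def rank : WeylType → ℕ
  | A n => n
  | B n => n
  | D n => n
  | G2 => 2
  | F4 => 4
  | E6 => 6
  | E7 => 7
  | E8 => 8

/-- The rank restrictions making the types distinct irreducible Weyl symbols. -/
def Valid : WeylType → Prop
  | A n => 1 ≤ n
  | B n => 2 ≤ n
  | D n => 4 ≤ n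
  | _ => True

/-- Coxeter matrix entry for sorted (0-based) indices `i ≤ j`.  Node `s_k` of the paper
(1-based) corresponds to the index `k - 1`. -/
def cmRaw : WeylType → ℕ → ℕ → ℕ
  | A _, i, j => if i = j then 1 else if i + 1 = j then 3 else 2
  | B n, i, j => if i = j then 1 else if i + 1 = j then (if j = n - 1 then 4 else 3) else 2
  | D n, i, j => if i = j then 1 else
      if (i + 1 = j ∧ j ≤ n - 2) ∨ (i = n - 3 ∧ j = n - 1) then 3 else 2
  | G2, i, j => if i = j then 1 else 6
  | F4, i, j => if i = j then 1 else if i + 1 = j then (if i = 1 then 4 else 3) else 2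
  | E6, i, j => if i = j then 1 else if (i + 1 = j ∧ j ≤ 4) ∨ (i = 2 ∧ j = 5) then 3 else 2
  | E7, i, j => if i = j then 1 else if (i + 1 = j ∧ j ≤ 5) ∨ (i = 2 ∧ j = 6) then 3 else 2
  | E8, i, j => if i = j then 1 else if (i + 1 = j ∧ j ≤ 6) ∨ (i = 2 ∧ j = 7) then 3 else 2

/-- The Coxeter matrix entry `m_{s t}` of the symbol, for 0-based indices. -/
def cm (t : WeylType) (i j : ℕ) : ℕ := cmRaw t (min i j) (max i j)

theorem cm_symm (t : WeylType) (i j : ℕ) : cm t i j = cm t j i := by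
  unfold cm; rw [min_comm, max_comm]

theorem cm_diag (t : WeylType) (i : ℕ) : cm t i i = 1 := by
  cases t <;> simp [cm, cmRaw]

theorem cmRaw_ne_one (t : WeylType) (i j : ℕ) (h : i ≠ j) : cmRaw t i j ≠ 1 := by
  cases t <;> simp only [cmRaw, if_neg h] <;> first | omega | (split_ifs <;> omega)

theorem cm_ne_one (t : WeylType) (i j : ℕ) (h : i ≠ j) : cm t i j ≠ 1 := by
  have : min i j ≠ max i j := by omega
  exact cmRaw_ne_one t _ _ this

end WeylType

open WeylType

/-- The Coxeter matrix of the irreducible Weyl symbol `t`. -/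
def weylCM (t : WeylType) : CoxeterMatrix (Fin t.rank) where
  M := Matrix.of fun i j => cm t i.val j.val
  isSymm := by
    unfold Matrix.IsSymm
    ext i j
    simpa [Matrix.of_apply] using cm_symm t j.val i.val
  diagonal := fun i => cm_diag t i.val
  off_diagonal := fun i j h => cm_ne_one t i.val j.val (by simpa [Fin.val_inj] using h)

/-- The visible (parabolic) subgroup of a Coxeter group generated by a subset of the nodes. -/
def visible {B W : Type*} [Group W] {M : CoxeterMatrix B} (cs : CoxeterSystem M W)
    (T : Set B) : Subgroup W :=
  Subgroup.closure (cs.simple '' T)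




open WeylType

/-- Cartan-type integers for the paper's root-lattice basis `x_1, ..., x_n`:
`cartan t i j = 2 (x_i, x_j) / (x_i, x_i)` (0-based indices). -/
def cartan (t : WeylType) (i j : ℕ) : ℤ :=
  if i = j then 2
  else if cm t i j = 2 then 0
  else
    match t with
    | .B n => if i + 1 = j ∧ j = n - 1 then -2 else -1
    | .G2 => if i = 0 then -3 else -1
    | .F4 => if i = 1 ∧ j = 2 then -2 else -1
    | _ => -1

/-- Twice the Gram matrix of the root-lattice basis: `gram t i j = 2 (x_i, x_j)`,
normalised so that the simple roots `v_i` are unit vectors. -/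
def gram (t : WeylType) (i j : ℕ) : ℤ :=
  if i = j then
    (match t with
     | .B n => if i = n - 1 then 4 else 2
     | .G2 => if i = 1 then 6 else 2
     | .F4 => if 2 ≤ i then 4 else 2
     | _ => 2)
  else if cm t i j = 2 then 0
  else
    (match t with
     | .B n => if max i j = n - 1 then -2 else -1
     | .G2 => -3
     | .F4 => if 2 ≤ max i j then -2 else -1
     | _ => -1)

/-- Twice the invariant inner product of two root-lattice vectors, written in
coordinates with respect to the basis `x_1, ..., x_n`. -/
def inner2 (t : WeylType) (u v : Fin t.rank → ℤ) : ℤ :=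
  ∑ i, ∑ j, u i * gram t i.val j.val * v j

/-- The matrix of the simple reflection `s_i` acting on the root lattice in the basis
`x_1, ..., x_n`: `s_i (x_j) = x_j - cartan t i j • x_i`. -/
def reflM (t : WeylType) (i : Fin t.rank) : Matrix (Fin t.rank) (Fin t.rank) ℤ :=
  Matrix.of fun k j => (if k = j then 1 else 0) - (if k = i then cartan t i.val j.val else 0)

/-- The reduction of `reflM` modulo `2`, i.e. the action of `s_i` on `L/2L`. -/
def reflM2 (t : WeylType) (i : Fin t.rank) : Matrix (Fin t.rank) (Fin t.rank) (ZMod 2) :=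
  (reflM t i).map (Int.cast)

/-- The matrix of the Coxeter element `s_1 s_2 ⋯ s_n` acting on the root lattice. -/
def coxM (t : WeylType) : Matrix (Fin t.rank) (Fin t.rank) ℤ :=
  ((List.finRange t.rank).map (reflM t)).prod

/-- `u` is (in coordinates w.r.t. `x_1, ..., x_n`) the paper's explicit vector `u_s`:
a nonzero primitive lattice vector orthogonal to `x_t` for all `t ≠ s`, on the positive
side of the wall determined by `x_s`. -/
def IsPaperVector (t : WeylType) (s : Fin t.rank) (u : Fin t.rank → ℤ) : Prop :=
  u ≠ 0 ∧ (Finset.univ.gcd fun i => (u i).natAbs) = 1 ∧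
    (∀ j : Fin t.rank, j ≠ s → inner2 t u (Pi.single j 1) = 0) ∧
    0 < inner2 t u (Pi.single s 1)

/-- `x_s = v_s`, i.e. the basis vector at the node `s` (0-based) is an unrescaled simple root. -/
def Unscaled : WeylType → ℕ → Prop
  | .B n, s => s ≠ n - 1
  | .F4, s => s ≠ 2 ∧ s ≠ 3
  | .G2, s => s ≠ 1
  | _, _ => True

/-- The list of vectors `ū, s_{q_1}(ū), s_{q_2} s_{q_1}(ū), ...` in `L/2L` obtained by
successively applying the reflections along a path `q_1, q_2, ...` in the symbol. -/
def pathVecs (t : WeylType) (w : Fin t.rank → ZMod 2) (p : List (Fin t.rank)) :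
    List (Fin t.rank → ZMod 2) :=
  p.scanl (fun v i => (reflM2 t i).mulVec v) w

/-- `p` is an injective path in the symbol of `t` all of whose edges are unlabelled
(label 3); equivalently, (in a tree) the minimal path between its endpoints spans a
subsymbol of type `A`. -/
def IsA3Path (t : WeylType) (p : List (Fin t.rank)) : Prop :=
  p.Nodup ∧ p.Chain' (fun i j => cm t i.val j.val = 3)

/-- The pair `(Ψ, s)` is specially admissible: `x_s = v_s` and for every node `t'` such that
the minimal path from `s` to `t'` spans a type `A_k` subsymbol, the `k + 1` vectors of
`X^s_{t'}` are linearly independent over `𝔽_2`. -/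
def SpeciallyAdmissible (t : WeylType) (s : Fin t.rank) : Prop :=
  Unscaled t s.val ∧
    ∀ u : Fin t.rank → ℤ, IsPaperVector t s u →
      ∀ p : List (Fin t.rank), p.head? = some s → IsA3Path t p →
        LinearIndependent (ZMod 2)
          (fun q : Fin (pathVecs t (fun i => ((u i : ZMod 2))) p).length =>
            (pathVecs t (fun i => ((u i : ZMod 2))) p).get q)

/-- The pair `(Ψ, s)` is admissible: as in `SpeciallyAdmissible`, but the independence is
required only along type `A_k` paths with `k` odd. -/
def Admissible (t : WeylType) (s : Fin t.rank) : Prop :=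
  Unscaled t s.val ∧
    ∀ u : Fin t.rank → ℤ, IsPaperVector t s u →
      ∀ p : List (Fin t.rank), p.head? = some s → IsA3Path t p → Odd p.length →
        LinearIndependent (ZMod 2)
          (fun q : Fin (pathVecs t (fun i => ((u i : ZMod 2))) p).length =>
            (pathVecs t (fun i => ((u i : ZMod 2))) p).get q)

/-- The exponents `m_1, ..., m_n` of the irreducible Weyl group of type `t`. -/
def exponents : WeylType → List ℕ
  | .A n => (List.range n).map (· + 1)
  | .B n => (List.range n).map (fun k => 2 * k + 1)
  | .D n => ((List.range (n - 1)).map (fun k => 2 * k + 1)) ++ [n - 1]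
  | .G2 => [1, 5]
  | .F4 => [1, 5, 7, 11]
  | .E6 => [1, 4, 5, 7, 8, 11]
  | .E7 => [1, 5, 7, 9, 11, 13, 17]
  | .E8 => [1, 7, 11, 13, 17, 19, 23, 29]

/-- `∏ (m_i + 1)`, which is the order of the Weyl group of type `t`. -/
def orderProd (t : WeylType) : ℕ := ((exponents t).map (· + 1)).prod

/-- The dimension `d_Ψ` of Theorem `section:lattices:result400` of the paper. -/
def dPsi : WeylType → ℕ
  | .A _ => 1
  | .B n => n
  | .D n => if Even n then n else n - 2
  | .G2 => 2
  | .F4 => 4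
  | .E6 => 2
  | .E7 => 7
  | .E8 => 8

/-- `ξ` is a Coxeter element: a product of all the simple reflections, each exactly once. -/
def IsCoxeterElt {B W : Type*} [Group W] {M : CoxeterMatrix B} (cs : CoxeterSystem M W)
    (ξ : W) : Prop :=
  ∃ l : List B, l.Nodup ∧ (∀ i, i ∈ l) ∧ ξ = (l.map cs.simple).prod

/-- The matrix of Coxeter entries of the symbol `(†)`: the Weyl symbol `Ψ` of type `t`
together with `m` new nodes `t_1, ..., t_m`, where `t_k` is joined to the node `s_{a k}`
of `Ψ` by an edge labelled `4` and to no other node. -/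
def daggerM (t : WeylType) {m : ℕ} (a : Fin m → Fin t.rank) :
    Matrix (Fin t.rank ⊕ Fin m) (Fin t.rank ⊕ Fin m) ℕ :=
  Matrix.of fun x y =>
    match x, y with
    | Sum.inl i, Sum.inl j => cm t i.val j.val
    | Sum.inl i, Sum.inr k => if a k = i then 4 else 2
    | Sum.inr k, Sum.inl i => if a k = i then 4 else 2
    | Sum.inr k, Sum.inr l => if k = l then 1 else 2

/-- The Coxeter matrix of the symbol `(†)`. -/
def daggerCM (t : WeylType) {m : ℕ} (a : Fin m → Fin t.rank) :
    CoxeterMatrix (Fin t.rank ⊕ Fin m) where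
  M := daggerM t a
  isSymm := by
    unfold Matrix.IsSymm
    ext x y
    rcases x with i | k <;> rcases y with j | l <;>
      simp only [Matrix.transpose_apply, daggerM, Matrix.of_apply] <;>
      first
        | rfl
        | exact cm_symm t _ _
        | simp [eq_comm]
  diagonal := by
    rintro (i | k) <;> simp [daggerM, cm_diag]
  off_diagonal := by
    rintro (i | k) (j | l) h <;> simp only [daggerM, Matrix.of_apply]
    · exact cm_ne_one t i.val j.val (by simpa [Fin.val_inj] using fun hh => h (by rw [hh]))
    · split_ifs <;> omega
    · split_ifs <;> omega
    · have : k ≠ l := fun hh => h (by rw [hh])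
      simp [this]

section Dagger

variable (t : WeylType) {m : ℕ}

/-- The image `ū_k` of the vector `u_k` in `L/2L`. -/
def ubar (u : Fin m → Fin t.rank → ℤ) (k : Fin m) : Fin t.rank → ZMod 2 :=
  fun i => ((u k i : ZMod 2))

variable {WΨ : Type*} [Group WΨ]

/-- `Λ_k / 2`: the `𝔽_2`-span of the `W(Ψ)`-orbit of `ū_k` in `L/2L`. -/
def Lambda (ρ2 : WΨ →* Module.End (ZMod 2) (Fin t.rank → ZMod 2))
    (u : Fin m → Fin t.rank → ℤ) (k : Fin m) : Submodule (ZMod 2) (Fin t.rank → ZMod 2) :=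
  Submodule.span (ZMod 2) {w | ∃ g : WΨ, w = ρ2 g (ubar t u k)}

/-- Membership in `∏_k Λ_k / 2`. -/
def InD (ρ2 : WΨ →* Module.End (ZMod 2) (Fin t.rank → ZMod 2))
    (u : Fin m → Fin t.rank → ℤ) (v : Fin m → Fin t.rank → ZMod 2) : Prop :=
  ∀ k, v k ∈ Lambda t ρ2 u k

/-- The tuple `𝐮_k ∈ ∏ Λ_j / 2` with `k`-th coordinate `ū_k` and all others `0`. -/
def uTup (u : Fin m → Fin t.rank → ℤ) (k : Fin m) : Fin m → Fin t.rank → ZMod 2 :=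
  Pi.single k (ubar t u k)

/-- `(G, π, ι)` realises the semidirect product `∏ Λ_k/2 ⋊ W(Ψ)` induced by the diagonal
action of `W(Ψ)`, with every element written uniquely as `ι 𝐯 * π g`. -/
structure SdpHyp (ρ2 : WΨ →* Module.End (ZMod 2) (Fin t.rank → ZMod 2))
    (u : Fin m → Fin t.rank → ℤ) {G : Type*} [Group G]
    (π : WΨ →* G) (ι : (Fin m → Fin t.rank → ZMod 2) → G) : Prop where
  map_zero : ι 0 = 1
  map_add : ∀ v w, InD t ρ2 u v → InD t ρ2 u w → ι (v + w) = ι v * ι w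
  inj : ∀ v w, InD t ρ2 u v → InD t ρ2 u w → ι v = ι w → v = w
  pi_inj : Function.Injective π
  conj : ∀ (g : WΨ) v, InD t ρ2 u v → π g * ι v * (π g)⁻¹ = ι fun k => ρ2 g (v k)
  decomp : ∀ x : G, ∃ v g, InD t ρ2 u v ∧ x = ι v * π g
  uniq : ∀ v w g h, InD t ρ2 u v → InD t ρ2 u w → ι v * π g = ι w * π h → v = w ∧ g = h

variable {WΓ : Type*} [Group WΓ]

/-- `φ : W(Γ) → ∏ Λ_k/2 ⋊ W(Ψ)` is the paper's homomorphism: it is determined by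
`φ(s) = (𝟎, s)` for nodes `s` of `Ψ` and `φ(t_k) = (𝐮_k, 1)`. -/
def PhiCond {a : Fin m → Fin t.rank} (csΓ : CoxeterSystem (daggerCM t a) WΓ)
    (csΨ : CoxeterSystem (weylCM t) WΨ) {G : Type*} [Group G] (π : WΨ →* G)
    (ι : (Fin m → Fin t.rank → ZMod 2) → G) (u : Fin m → Fin t.rank → ℤ)
    (φ : WΓ →* G) : Prop :=
  (∀ j : Fin t.rank, φ (csΓ.simple (Sum.inl j)) = π (csΨ.simple j)) ∧
    (∀ k : Fin m, φ (csΓ.simple (Sum.inr k)) = ι (uTup t u k))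

/-- The all-ones vector: the value of `ε = (f_1, ..., f_ℓ)` on any Coxeter generator other
than the `t_i`. -/
def onesVec (l : ℕ) : Fin l → ZMod 2 := fun _ => 1

/-- The value of `ε = (f_1, ..., f_ℓ)` on the Coxeter generator `t_k`. -/
def epsVec (l : ℕ) {m : ℕ} (k : Fin m) : Fin l → ZMod 2 :=
  fun i => if (i : ℕ) = (k : ℕ) then 0 else 1

/-- `φ̂ = ε × φ : W(Γ) → (ℤ/2)^ℓ × (∏ Λ_k/2 ⋊ W(Ψ))` is the paper's homomorphism,
determined by its values on the Coxeter generators. -/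
def PhiHatCond {a : Fin m → Fin t.rank} (csΓ : CoxeterSystem (daggerCM t a) WΓ)
    (csΨ : CoxeterSystem (weylCM t) WΨ) {G : Type*} [Group G] (π : WΨ →* G)
    (ι : (Fin m → Fin t.rank → ZMod 2) → G) (u : Fin m → Fin t.rank → ℤ) (l : ℕ)
    (φh : WΓ →* Multiplicative (Fin l → ZMod 2) × G) : Prop :=
  (∀ j : Fin t.rank, φh (csΓ.simple (Sum.inl j)) =
      (Multiplicative.ofAdd (onesVec l), π (csΨ.simple j))) ∧
    (∀ k : Fin m, φh (csΓ.simple (Sum.inr k)) =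
      (Multiplicative.ofAdd (epsVec l k), ι (uTup t u k)))

/-- `w` is the longest element of the visible subgroup `W(Δ)` on the set of nodes `T`. -/
def IsLongest {B : Type*} {M : CoxeterMatrix B} (cs : CoxeterSystem M WΓ) (T : Set B)
    (w : WΓ) : Prop :=
  w ∈ visible cs T ∧ ∀ w' ∈ visible cs T, cs.length w' ≤ cs.length w

/-- `w` is the element of `W(Δ)`, `Δ ⊆ Ψ` the subsymbol on the nodes `T`, acting as the
antipodal map on the span of the roots of `Δ`; its existence says exactly that `Δ` is a
subsymbol of `(-1)`-type and `w = w_Δ` is its element of longest length. -/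
def IsMinusOneElt (csΨ : CoxeterSystem (weylCM t) WΨ)
    (ρ : WΨ →* Module.End ℤ (Fin t.rank → ℤ)) (T : Finset (Fin t.rank)) (w : WΨ) : Prop :=
  w ∈ visible csΨ (T : Set (Fin t.rank)) ∧
    ∀ i ∈ T, ρ w (Pi.single i 1) = -Pi.single i 1

/-- `z` is an involution. -/
def Invol {G : Type*} [Group G] (z : G) : Prop := z ≠ 1 ∧ z * z = 1

/-- Two nodes of the symbol `(†)` are joined by an edge. -/
def Adjacent (a : Fin m → Fin t.rank) (x y : Fin t.rank ⊕ Fin m) : Prop :=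
  x ≠ y ∧ daggerM t a x y ≠ 2

/-- The subsymbol of `(†)` on the set of nodes `T` is connected. -/
def ConnectedSym (a : Fin m → Fin t.rank) (T : Finset (Fin t.rank ⊕ Fin m)) : Prop :=
  T.Nonempty ∧ ∀ x ∈ T, ∀ y ∈ T,
    Relation.ReflTransGen (fun z w => z ∈ T ∧ w ∈ T ∧ Adjacent t a z w) x y

/-- The subsymbol of `(†)` on the set of nodes `T` is of type `B_k` (where `B_1 = A_1`). -/
def IsTypeB (a : Fin m → Fin t.rank) (T : Finset (Fin t.rank ⊕ Fin m)) (k : ℕ) : Prop :=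
  ∃ e : Fin k ≃ {x // x ∈ T}, ∀ i j : Fin k,
    daggerM t a (e i).val (e j).val = cm (WeylType.B k) i.val j.val

end Dagger


/-- A predicate on `{0, ..., m - 1}` stable under passing to neighbours in both directions
holds everywhere as soon as it holds somewhere. -/
theorem forall_lt_of_neighbours {P : ℕ → Prop} {m s : ℕ}
    (up : ∀ i, i + 1 < m → P i → P (i + 1)) (down : ∀ i, i + 1 < m → P (i + 1) → P i)
    (hs : s < m) (h : P s) : ∀ j < m, P j := by
  have h0 : P 0 := by
    induction s with
    | zero => exact h
    | succ k ih => exact ih (by omega) (down k hs h)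
  intro j hj
  induction j with
  | zero => exact h0
  | succ k ih => exact up k hj (ih (by omega))

/-- The analogue of `forall_lt_of_neighbours` for a chain `0, ..., m - 1` with one further
node `m` attached at `b`. -/
theorem forall_lt_of_tail_branch {P : ℕ → Prop} {m b s : ℕ} (hb : b < m)
    (up : ∀ i, i + 1 < m → P i → P (i + 1)) (down : ∀ i, i + 1 < m → P (i + 1) → P i)
    (out : P b → P m) (into : P m → P b) (hs : s < m + 1) (h : P s) : ∀ j < m + 1, P j := by
  have key : ∀ j < m, P j := by
    obtain hs' | rfl : s < m ∨ s = m := by omega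
    · exact forall_lt_of_neighbours up down hs' h
    · exact forall_lt_of_neighbours up down hb (into h)
  intro j hj
  obtain hj' | rfl : j < m ∨ j = m := by omega
  · exact key j hj'
  · exact out (key b hb)

/-- A predicate on the nodes of `t` which passes from `i` to `j` whenever `cartan t j i` is odd
holds at every node if it holds at a node whose simple root is not rescaled. -/
theorem forall_node_of_unscaled {t : WeylType} (hval : t.Valid) {P : ℕ → Prop}
    (step : ∀ i j, i < t.rank → j < t.rank → Odd (cartan t j i) → P i → P j)
    {s : ℕ} (hs : s < t.rank) (hsc : Unscaled t s) (h : P s) : ∀ j < t.rank, P j := by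
  cases t with
  | A n =>
    simp only [rank] at hs step ⊢
    refine forall_lt_of_neighbours (fun i hi => step i (i + 1) (by omega) hi ?_)
      (fun i hi => step (i + 1) i hi (by omega) ?_) hs h
    all_goals simp [cartan, cm, cmRaw]
  | B n =>
    simp only [rank, Valid, Unscaled] at hs step hval hsc ⊢
    have up : ∀ i, i + 1 < n → P i → P (i + 1) := fun i hi =>
      step i (i + 1) (by omega) hi <| by
        have : (if i + 1 = n - 1 then 4 else 3) ≠ 2 := by split_ifs <;> omega
        simp [cartan, cm, cmRaw, this, show i + 1 + 1 ≠ i by omega]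
    have key := forall_lt_of_neighbours (m := n - 1) (fun i hi => up i (by omega))
      (fun i hi => step (i + 1) i (by omega) (by omega) <| by
        simp [cartan, cm, cmRaw, show i + 1 ≠ n - 1 by omega]) (by omega) h
    intro j hj
    obtain hj' | rfl : j < n - 1 ∨ j = n - 2 + 1 := by omega
    · exact key j hj'
    · exact up (n - 2) (by omega) (key _ (by omega))
  | D n =>
    simp only [rank, Valid] at hs step hval ⊢
    have hn : n - 1 + 1 = n := by omega
    rw [← hn] at hs ⊢
    refine forall_lt_of_tail_branch (b := n - 3) (by omega)
      (fun i hi => step i (i + 1) (by omega) (by omega) ?_)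
      (fun i hi => step (i + 1) i (by omega) (by omega) ?_)
      (step (n - 3) (n - 1) (by omega) (by omega) ?_)
      (step (n - 1) (n - 3) (by omega) (by omega) ?_) hs h
    · simp [cartan, cm, cmRaw, show i + 1 ≤ n - 2 by omega]
    · simp [cartan, cm, cmRaw, show i + 1 ≤ n - 2 by omega]
    all_goals
      simp [cartan, cm, cmRaw, show n - 3 ≤ n - 1 by omega, show n - 1 ≠ n - 3 by omega,
        show n - 3 ≠ n - 1 by omega]
  | G2 =>
    simp only [rank] at hs step ⊢
    exact forall_lt_of_neighbours
      (fun i hi => step i (i + 1) (by omega) hi <| by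
        obtain rfl : i = 0 := by omega
        decide)
      (fun i hi => step (i + 1) i hi (by omega) <| by
        obtain rfl : i = 0 := by omega
        decide) hs h
  | F4 =>
    simp only [rank, Unscaled] at hs step hsc ⊢
    have up : ∀ i, i + 1 < 4 → P i → P (i + 1) := fun i hi =>
      step i (i + 1) (by omega) hi <| by
        obtain rfl | rfl | rfl : i = 0 ∨ i = 1 ∨ i = 2 := by omega
        all_goals decide
    have key := forall_lt_of_neighbours (m := 2) (fun i hi => up i (by omega))
      (fun i hi => step (i + 1) i (by omega) (by omega) <| by
        obtain rfl : i = 0 := by omega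
        decide) (by omega) h
    have h2 : P 2 := up 1 (by omega) (key 1 (by omega))
    intro j hj
    obtain hj' | rfl | rfl : j < 2 ∨ j = 2 ∨ j = 3 := by omega
    · exact key j hj'
    · exact h2
    · exact up 2 (by omega) h2
  | E6 | E7 | E8 =>
    simp only [rank] at hs step ⊢
    refine forall_lt_of_tail_branch (b := 2) (by omega) ?_ ?_ ?_ ?_ hs h
    · exact fun i hi => step i (i + 1) (by omega) (by omega) (by
        have : i < 6 := by omega
        interval_cases i <;> first | decide | omega)
    · exact fun i hi => step (i + 1) i (by omega) (by omega) (by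
        have : i < 6 := by omega
        interval_cases i <;> first | decide | omega)
    · exact step 2 _ (by omega) (by omega) (by decide)
    · exact step _ 2 (by omega) (by omega) (by decide)

/-- `s_i` adds a multiple of `x_i`. -/
theorem reflM2_mulVec (t : WeylType) (i : Fin t.rank) (w : Fin t.rank → ZMod 2) :
    (reflM2 t i).mulVec w =
      w - Pi.single i (∑ j : Fin t.rank, (cartan t i.val j.val : ZMod 2) * w j) := by
  ext k
  have hentry : ∀ j, reflM2 t i k j =
      (1 : Matrix (Fin t.rank) (Fin t.rank) (ZMod 2)) k j -
        if k = i then (cartan t i.val j.val : ZMod 2) else 0 := by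
    intro j
    simp only [reflM2, reflM, Matrix.map_apply, Matrix.of_apply, Matrix.one_apply]
    push_cast
    rfl
  simp only [Matrix.mulVec, dotProduct, hentry, sub_mul, Finset.sum_sub_distrib, Pi.sub_apply]
  congr 1
  · simp [Matrix.one_apply]
  · by_cases hk : k = i <;> simp [hk]

/-- The coefficient of `x_s` by which `s` moves `ū_s` is odd for an admissible pair. -/
theorem Admissible.reflM2_mulVec_eq {t : WeylType} {s : Fin t.rank} (hadm : Admissible t s)
    {u : Fin t.rank → ℤ} (hu : IsPaperVector t s u) :
    (reflM2 t s).mulVec (fun i => (u i : ZMod 2)) =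
      (fun i => (u i : ZMod 2)) - Pi.single s 1 := by
  have hli := hadm.2 u hu [s] rfl ⟨List.nodup_singleton s, List.isChain_singleton s⟩ (by simp)
  have hne : (fun i => (u i : ZMod 2)) ≠ (reflM2 t s).mulVec (fun i => (u i : ZMod 2)) :=
    fun heq => absurd (hli.injective (a₁ := (⟨0, by simp [pathVecs]⟩ : Fin _))
      (a₂ := ⟨1, by simp [pathVecs]⟩) (by simpa [pathVecs] using heq)) (by simp)
  rw [reflM2_mulVec] at hne ⊢
  generalize (∑ j : Fin t.rank, (cartan t s.val j.val : ZMod 2) * (u j : ZMod 2)) = c at hne ⊢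
  obtain rfl | rfl := (by decide : ∀ c : ZMod 2, c = 0 ∨ c = 1) c
  · simp at hne
  · rfl

/-- If `s_j` preserves a subspace containing `x_i` and `cartan t j i` is odd, then the subspace
contains `x_j`. -/
theorem single_mem_of_odd_cartan {t : WeylType}
    {S : Submodule (ZMod 2) (Fin t.rank → ZMod 2)} {i j : Fin t.rank}
    (hS : ∀ w ∈ S, (reflM2 t j).mulVec w ∈ S) (hodd : Odd (cartan t j.val i.val))
    (hi : Pi.single i 1 ∈ S) : Pi.single j 1 ∈ S := by
  have h := S.sub_mem hi (hS _ hi)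
  have hcast : (cartan t j.val i.val : ZMod 2) = 1 := (ZMod.intCast_eq_one_iff_odd).2 hodd
  rw [reflM2_mulVec, sub_sub_cancel] at h
  simpa [Pi.single_apply, hcast] using h

/-- If `(Ψ, s)` is admissible then the `W(Ψ)`-orbit of `ū_s` spans all of
the `n`-dimensional space `L/2L` over `𝔽_2`. -/
theorem statement4 (t : WeylType) (hval : t.Valid) (s : Fin t.rank)
    (hadm : Admissible t s) (u : Fin t.rank → ℤ) (hu : IsPaperVector t s u) :
    Submodule.span (ZMod 2)
      {w : Fin t.rank → ZMod 2 |
        ∃ g ∈ Submonoid.closure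
            (Set.range fun i =>
              ((reflM2 t i).mulVecLin : Module.End (ZMod 2) (Fin t.rank → ZMod 2))),
          w = g (fun i => ((u i : ZMod 2)))} = ⊤ := by
  set S := Submodule.span (ZMod 2)
    {w : Fin t.rank → ZMod 2 |
      ∃ g ∈ Submonoid.closure
          (Set.range fun i =>
            ((reflM2 t i).mulVecLin : Module.End (ZMod 2) (Fin t.rank → ZMod 2))),
        w = g (fun i => ((u i : ZMod 2)))} with hSdef
  have hinv : ∀ i, ∀ w ∈ S, (reflM2 t i).mulVec w ∈ S := by
    intro i
    suffices S ≤ S.comap (reflM2 t i).mulVecLin from fun w hw => this hw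
    refine Submodule.span_le.2 ?_
    rintro _ ⟨g, hg, rfl⟩
    exact Submodule.subset_span
      ⟨(reflM2 t i).mulVecLin * g, mul_mem (Submonoid.subset_closure ⟨i, rfl⟩) hg, rfl⟩
  have hmem : (fun i => (u i : ZMod 2)) ∈ S := Submodule.subset_span ⟨1, one_mem _, rfl⟩
  have hsingle : (Pi.single s 1 : Fin t.rank → ZMod 2) ∈ S := by
    have h := S.sub_mem hmem (hinv s _ hmem)
    rwa [hadm.reflM2_mulVec_eq hu, sub_sub_cancel] at h
  have hall := forall_node_of_unscaled hval
    (P := fun i => ∀ h : i < t.rank, (Pi.single ⟨i, h⟩ 1 : Fin t.rank → ZMod 2) ∈ S)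
    (fun i j hi _ hodd hP hj =>
      single_mem_of_odd_cartan (i := ⟨i, hi⟩) (hinv ⟨j, hj⟩) hodd (hP hi))
    s.isLt hadm.1 (fun _ => hsingle)
  rw [eq_top_iff, ← (Pi.basisFun (ZMod 2) (Fin t.rank)).span_eq, Submodule.span_le]
  rintro _ ⟨j, rfl⟩
  simpa using hall j.val j.isLt j.isLt

end RootPaper
end
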